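/- arXiv:math/0207306 — 2 statements merged into one kernel-verified Lean document; each statement's English description precedes it below -/
import Mathlib

section
/- Let a be a squarefree integer ≠ 1, k = ℚ(√a), and p a prime not dividing the discriminant of k. If there exist rational numbers x, y with p = x² − a·y², then p splits in k as p = 𝔭𝔭' and 𝔭 is equivalent in the narrow class group to the square of a fractional ideal. -/
open NumberField
open scoped nonZeroDivisors

open Polynomial in
theorem dvd_of_sq_sub_mul_add_eq_zero {R : Type*} [CommRing R] [IsDomain R] [IsIntegrallyClosed R]
    {g z t c : R} (hg : g ≠ 0) (h : z ^ 2 - g * t * z + g ^ 2 * c = 0) : g ∣ z := by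
  have hg' : algebraMap R (FractionRing R) g ≠ 0 := by simpa using hg
  have hint : IsIntegral R (algebraMap R (FractionRing R) z / algebraMap R (FractionRing R) g) := by
    refine ⟨X ^ 2 - C t * X + C c, by monicity!, ?_⟩
    have h' := congrArg (algebraMap R (FractionRing R)) h
    simp only [map_add, map_sub, map_mul, map_pow, map_zero] at h'
    simp only [eval₂_add, eval₂_sub, eval₂_mul, eval₂_pow, eval₂_X, eval₂_C]
    field_simp
    linear_combination h'
  obtain ⟨w, hw⟩ := IsIntegrallyClosed.isIntegral_iff.mp hint
  refine ⟨w, IsFractionRing.injective R (FractionRing R) ?_⟩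
  rw [map_mul, hw]
  field_simp

theorem exists_nat_mul_map_eq_span {R : Type*} [CommRing R] [IsDomain R] [IsIntegrallyClosed R]
    (s : R ≃+* R) (hs : ∀ x, s (s x) = x) (hfix : ∀ x, s x = x → ∃ m : ℤ, x = m)
    {I : Ideal R} (hI : I ≠ ⊥) :
    ∃ n : ℕ, (n : R) ≠ 0 ∧ I * I.map s = Ideal.span {(n : R)} := by
  obtain ⟨g, hg⟩ := (IsPrincipalIdealRing.principal
    ((I * I.map s).comap (Int.castRingHom R))).principal
  have hdvd (k : ℤ) (hk : (k : R) ∈ I * I.map s) : g ∣ k := by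
    rw [← Ideal.mem_span_singleton, Ideal.span, ← hg]
    exact hk
  have hmem : (g : R) ∈ I * I.map s := by
    have : g ∈ (I * I.map s).comap (Int.castRingHom R) := by
      rw [hg]; exact Submodule.mem_span_singleton_self g
    exact this
  have hconj {x y : R} (hx : x ∈ I) (hy : y ∈ I) : x * s y ∈ I * I.map s :=
    Ideal.mul_mem_mul hx (Ideal.mem_map_of_mem s hy)
  have hnorm {x : R} (hx : x ∈ I) : ∃ c : ℤ, x * s x = (g * c : R) := by
    obtain ⟨m, hm⟩ := hfix (x * s x) (by rw [map_mul, hs, mul_comm])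
    obtain ⟨c, rfl⟩ := hdvd m (hm ▸ hconj hx hx)
    exact ⟨c, by rw [hm]; push_cast; rfl⟩
  have hg0 : (g : R) ≠ 0 := by
    obtain ⟨x, hx, hx0⟩ := Submodule.exists_mem_ne_zero_of_ne_bot hI
    obtain ⟨c, hc⟩ := hnorm hx
    rintro h0
    rw [h0, zero_mul] at hc
    simp_all
  have hspan : Ideal.span {((g.natAbs : ℕ) : R)} = Ideal.span {(g : R)} := by
    rcases Int.natAbs_eq g with h | h
    · conv_rhs => rw [h]
      simp
    · conv_rhs => rw [h]
      simp [Ideal.span_singleton_neg]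
  refine ⟨g.natAbs, ?_, ?_⟩
  · intro h0
    rw [h0] at hspan
    exact hg0 (Ideal.span_singleton_eq_bot.mp (hspan.symm.trans (by simp)))
  rw [hspan]
  refine le_antisymm (Ideal.mul_le.mpr fun x hx y' hy' => ?_)
    ((Ideal.span_singleton_le_iff_mem _).mpr hmem)
  obtain ⟨y, hy, rfl⟩ := (Ideal.mem_map_of_equiv s y').mp hy'
  obtain ⟨c, hc⟩ := hnorm hx
  obtain ⟨d, hd⟩ := hnorm hy
  obtain ⟨m, hm⟩ := hfix (x * s y + y * s x) (by simp only [map_add, map_mul, hs]; ring)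
  obtain ⟨t, rfl⟩ := hdvd m (hm ▸ add_mem (hconj hx hy) (hconj hy hx))
  push_cast at hm
  rw [Ideal.mem_span_singleton]
  refine dvd_of_sq_sub_mul_add_eq_zero (t := t) (c := c * d) hg0 ?_
  linear_combination (x * s y) * hm - (y * s y) * hc - g * c * hd

/-- A prime element fixed by an automorphism `s` divides every `x * s x` an even number of times. -/
theorem not_prime_of_mul_conj_eq {R : Type*} [CommRing R] [IsDomain R] [WfDvdMonoid R]
    (s : R ≃+* R) {q l m : R} (hq : s q = q) (hm : m ≠ 0) (h : l * s l = q * m ^ 2) :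
    ¬ Prime q := by
  intro hp
  have hl : l ≠ 0 := by
    rintro rfl
    simp [hp.ne_zero, hm] at h
  have hsl : emultiplicity q (s l) = emultiplicity q l := by
    conv_lhs => rw [← hq]
    exact emultiplicity_map_eq s
  have hfin {x : R} (hx : x ≠ 0) : FiniteMultiplicity q x :=
    FiniteMultiplicity.of_not_isUnit hp.not_isUnit hx
  have h2 := congrArg (emultiplicity q) h
  rw [emultiplicity_mul hp, emultiplicity_mul hp, emultiplicity_pow hp, hsl,
    (hfin hl).emultiplicity_eq_multiplicity, (hfin hm).emultiplicity_eq_multiplicity,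
    (hfin hp.ne_zero).emultiplicity_self] at h2
  norm_cast at h2
  omega

theorem map_map_involution {R : Type*} [CommRing R]
    (s : R ≃+* R) (hs : ∀ x, s (s x) = x) (I : Ideal R) : (I.map s).map s = I := by
  have : (s : R →+* R).comp (s : R →+* R) = RingHom.id R := RingHom.ext hs
  exact (Ideal.map_map (s : R →+* R) (s : R →+* R)).trans (by rw [this, Ideal.map_id])

theorem dvd_of_natCast_dvd_natCast {R : Type*} [CommRing R] [IsDomain R] [CharZero R]
    (s : R ≃+* R) (hfix : ∀ x, s x = x → ∃ m : ℤ, x = m) {n k : ℕ} (hn : n ≠ 0)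
    (h : (n : R) ∣ k) : n ∣ k := by
  obtain ⟨w, hw⟩ := h
  have hsw : s w = w := by
    apply mul_left_cancel₀ (Nat.cast_ne_zero.mpr hn : (n : R) ≠ 0)
    rw [← hw, ← map_natCast s n, ← map_mul, ← hw, map_natCast]
  obtain ⟨w, rfl⟩ := hfix w hsw
  have : (k : ℤ) = n * w := by exact_mod_cast hw
  exact Int.natCast_dvd_natCast.mp ⟨w, this⟩

theorem exists_isPrime_span_eq_mul_map {R : Type*} [CommRing R] [IsDedekindDomain R] [CharZero R]
    (s : R ≃+* R) (hs : ∀ x, s (s x) = x) (hfix : ∀ x, s x = x → ∃ m : ℤ, x = m)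
    {p : ℕ} (hp : p.Prime) {l m : R} (hm : m ≠ 0)
    (h : l * s l = p * m ^ 2) :
    ∃ P : Ideal R, P.IsPrime ∧ Ideal.span {(p : R)} = P * P.map s := by
  obtain ⟨P, hPmax, hP⟩ := Ideal.exists_le_maximal (Ideal.span {(p : R)})
    (by
      rw [Ne, Ideal.span_singleton_eq_top, isUnit_iff_dvd_one]
      intro hdvd
      exact hp.one_lt.ne' (Nat.dvd_one.mp
        (dvd_of_natCast_dvd_natCast s hfix hp.ne_zero (by simpa using hdvd))))
  have hp0 : (p : R) ≠ 0 := Nat.cast_ne_zero.mpr hp.ne_zero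
  have hspan0 : Ideal.span {(p : R)} ≠ ⊥ := by simpa using hp0
  have hP0 : P ≠ ⊥ := ne_bot_of_le_ne_bot hspan0 hP
  have hsp : (Ideal.span {(p : R)}).map s = Ideal.span {(p : R)} := by
    rw [Ideal.map_span, Set.image_singleton, map_natCast]
  obtain ⟨J, hJ⟩ := Ideal.dvd_iff_le.mpr hP
  have hJ0 : J ≠ ⊥ := by
    rintro rfl
    exact hspan0 (by simpa using hJ)
  obtain ⟨n, hn0, hn⟩ := exists_nat_mul_map_eq_span s hs hfix hP0
  obtain ⟨k, hk0, hk⟩ := exists_nat_mul_map_eq_span s hs hfix hJ0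
  have hnk : Ideal.span {((n * k : ℕ) : R)} = Ideal.span {((p ^ 2 : ℕ) : R)} := by
    have h1 : Ideal.span {(p : R)} * (Ideal.span {(p : R)}).map s =
        (P * J) * (P * J).map s := by rw [← hJ]
    rw [hsp, Ideal.map_mul, mul_mul_mul_comm, hn, hk, Ideal.span_singleton_mul_span_singleton,
      Ideal.span_singleton_mul_span_singleton] at h1
    push_cast
    rw [sq, h1]
  have hdvd : n ∣ p ^ 2 := by
    have h1 : (n : R) ∣ ((p ^ 2 : ℕ) : R) := by
      rw [← Ideal.mem_span_singleton]
      have : ((p ^ 2 : ℕ) : R) ∈ Ideal.span {((n * k : ℕ) : R)} :=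
        hnk ▸ Ideal.mem_span_singleton_self _
      rw [Ideal.mem_span_singleton] at this ⊢
      exact (Dvd.intro _ (by push_cast; rfl)).trans this
    exact dvd_of_natCast_dvd_natCast s hfix (by rintro rfl; simp at hn0) h1
  obtain ⟨i, hi, rfl⟩ := (Nat.dvd_prime_pow hp).mp hdvd
  have hPtop : P * P.map s ≠ ⊤ := fun htop =>
    hPmax.ne_top (top_le_iff.mp (htop ▸ Ideal.mul_le_left))
  interval_cases i
  · exact absurd (by simpa using hn) hPtop
  · exact ⟨P, hPmax.isPrime, by simpa using hn.symm⟩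
  · exfalso
    have hJtop : J = ⊤ := by
      have h1 : Ideal.span {((p ^ 2 : ℕ) : R)} * Ideal.span {(k : R)} =
          Ideal.span {((p ^ 2 : ℕ) : R)} * 1 := by
        rw [Ideal.span_singleton_mul_span_singleton, mul_one, ← hnk]
        push_cast
        rfl
      have h2 := mul_left_cancel₀ (by simpa using hp0) h1
      rw [Ideal.one_eq_top] at h2
      exact top_le_iff.mp (h2 ▸ hk ▸ Ideal.mul_le_left)
    rw [hJtop, Ideal.mul_top] at hJ
    refine not_prime_of_mul_conj_eq s (map_natCast s p) hm h ?_
    rw [← Ideal.span_singleton_prime hp0, hJ]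
    exact hPmax.isPrime

/-- An ideal-theoretic form of Hilbert's theorem 90 for an involution. -/
theorem exists_span_eq_mul_sq {R : Type*} [CommRing R] [IsDedekindDomain R] [CharZero R]
    (s : R ≃+* R) (hs : ∀ x, s (s x) = x) (hfix : ∀ x, s x = x → ∃ m : ℤ, x = m)
    {p m : ℕ} (hp : p ≠ 0) (hm : m ≠ 0) {l : R} (h : l * s l = p * m ^ 2)
    {P : Ideal R} (hP : Ideal.span {(p : R)} = P * P.map s) :
    ∃ (n : ℕ) (C : Ideal R), n ≠ 0 ∧ C ≠ ⊥ ∧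
      Ideal.span {l * n} = Ideal.span {(m : R)} * P * C ^ 2 := by
  set D : Ideal R := Ideal.span {(m : R)} * Ideal.span {(p : R)} with hD
  set A : Ideal R := Ideal.span {l} * P.map s with hA
  have hspan (k : ℕ) : (Ideal.span {(k : R)}).map s = Ideal.span {(k : R)} := by
    rw [Ideal.map_span, Set.image_singleton, map_natCast]
  have hspan0 {k : ℕ} (hk : k ≠ 0) : Ideal.span {(k : R)} ≠ 0 := by simpa using hk
  have hsD : D.map s = D := by rw [hD, Ideal.map_mul, hspan, hspan]
  have hAA : A * A.map s = D * D := by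
    have : (Ideal.span {l}).map s = Ideal.span {s l} := by
      rw [Ideal.map_span, Set.image_singleton]
    calc A * A.map s = (Ideal.span {l} * Ideal.span {s l}) * (P * P.map s) := by
          rw [hA, Ideal.map_mul, map_map_involution s hs, this]; ring
      _ = D * D := by
          rw [Ideal.span_singleton_mul_span_singleton, h, ← hP, hD,
            ← Ideal.span_singleton_mul_span_singleton, ← Ideal.span_singleton_pow]
          ring
  have hD0 : D ≠ 0 := mul_ne_zero (hspan0 hm) (hspan0 hp)
  have hC0 : D ⊔ A ≠ ⊥ := ne_bot_of_le_ne_bot hD0 le_sup_left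
  obtain ⟨n, hn0, hn⟩ := exists_nat_mul_map_eq_span s hs hfix hC0
  refine ⟨n, D ⊔ A, by rintro rfl; simp at hn0, hC0, ?_⟩
  have hAC : A * (D ⊔ A).map s = D * (D ⊔ A) := by
    rw [Ideal.map_sup, hsD, Ideal.mul_sup, Ideal.mul_sup, hAA, sup_comm, mul_comm A D]
  have key : A * Ideal.span {(n : R)} = D * (D ⊔ A) ^ 2 := by
    rw [← hn, mul_left_comm, hAC]; ring
  apply mul_left_cancel₀ (hspan0 hp)
  calc Ideal.span {(p : R)} * Ideal.span {l * n}
      = P * (A * Ideal.span {(n : R)}) := by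
        rw [hP, ← Ideal.span_singleton_mul_span_singleton, hA]; ring
    _ = _ := by rw [key, hD]; ring

open Polynomial in
theorem exists_conj_of_adjoin_sqrt {a : ℤ} (ha : Squarefree a) (ha1 : a ≠ 1)
    {K : Type*} [Field K] [NumberField K] {α : K} (hα : α ^ 2 = (a : K))
    (hgen : Algebra.adjoin ℚ {α} = ⊤) :
    ∃ σ : K ≃ₐ[ℚ] K, σ α = -α ∧ (∀ z, σ (σ z) = z) ∧ ∀ z, σ z = z → ∃ q : ℚ, z = q := by
  have hrat : ∀ q : ℚ, α ≠ q := by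
    rintro q rfl
    have hq : q ^ 2 = (a : ℚ) := by exact_mod_cast hα
    obtain ⟨b, hb⟩ : IsSquare a := by
      rw [← Rat.isSquare_intCast_iff]
      exact ⟨q, by rw [← hq, sq]⟩
    rcases Int.isUnit_iff.mp (ha b ⟨1, by rw [hb, mul_one]⟩) with rfl | rfl <;> simp_all
  have hsplit : IsSplittingField ℚ K (X ^ 2 - C (a : ℚ)) := by
    have hfac : (X ^ 2 - C (a : ℚ)).map (algebraMap ℚ K) = (X - C α) * (X - C (-α)) := by
      have hC : (C α : K[X]) ^ 2 = C (a : K) := by rw [← C_pow, hα]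
      simp only [Polynomial.map_sub, Polynomial.map_pow, map_X, Polynomial.map_C, eq_ratCast,
        Rat.cast_intCast, C_neg]
      linear_combination hC
    refine ⟨?_, ?_⟩
    · rw [hfac]
      exact (Splits.X_sub_C _).mul (Splits.X_sub_C _)
    · rw [eq_top_iff, ← hgen]
      refine Algebra.adjoin_mono (Set.singleton_subset_iff.mpr ?_)
      rw [mem_rootSet]
      exact ⟨X_pow_sub_C_ne_zero two_pos _, by simp [hα]⟩
  have hnormal : Normal ℚ K := Normal.of_isSplittingField (X ^ 2 - C (a : ℚ))
  have hgal : IsGalois ℚ K := ⟨⟩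
  obtain ⟨σ, hσ⟩ : ∃ σ : K ≃ₐ[ℚ] K, σ α ≠ α := by
    by_contra! hcon
    obtain ⟨q, hq⟩ := IntermediateField.mem_bot.mp ((IsGalois.mem_bot_iff_fixed α).mpr hcon)
    exact hrat q (by simpa using hq.symm)
  have hσα : σ α = -α := by
    refine (sq_eq_sq_iff_eq_or_eq_neg.mp ?_).resolve_left hσ
    rw [← map_pow, hα, map_intCast]
  have hform (z : K) : ∃ u v : ℚ, z = u + v * α := by
    have hz : z ∈ Algebra.adjoin ℚ {α} := hgen ▸ Algebra.mem_top
    induction hz using Algebra.adjoin_induction with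
    | mem x hx => exact ⟨0, 1, by simpa using hx⟩
    | algebraMap r => exact ⟨r, 0, by simp⟩
    | add x y _ _ hx hy =>
      obtain ⟨u, v, rfl⟩ := hx
      obtain ⟨u', v', rfl⟩ := hy
      exact ⟨u + u', v + v', by push_cast; ring⟩
    | mul x y _ _ hx hy =>
      obtain ⟨u, v, rfl⟩ := hx
      obtain ⟨u', v', rfl⟩ := hy
      exact ⟨u * u' + v * v' * a, u * v' + v * u', by
        push_cast; linear_combination (v * v' : K) * hα⟩
  refine ⟨σ, hσα, fun z => ?_, fun z hz => ?_⟩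
  · obtain ⟨u, v, rfl⟩ := hform z
    simp [hσα]
  · obtain ⟨u, v, rfl⟩ := hform z
    simp only [map_add, map_mul, map_ratCast, hσα] at hz
    have : (v : K) * α = 0 := by linear_combination (-1 / 2 : K) * hz
    exact ⟨u, by rw [this, add_zero]⟩

theorem exists_nat_mul_add_mul_mem_ringOfIntegers {a : ℤ} {K : Type*} [Field K] [NumberField K]
    {α : K} (hα : α ^ 2 = (a : K)) (x y : ℚ) :
    ∃ (m : ℕ) (l : 𝓞 K), m ≠ 0 ∧ (l : K) = m * (x + y * α) := by
  have hint : IsIntegral ℤ α := by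
    refine IsIntegral.of_pow two_pos ?_
    rw [hα]
    exact isIntegral_algebraMap (R := ℤ) (x := a)
  obtain ⟨α', hα'⟩ : ∃ α' : 𝓞 K, (α' : K) = α := ⟨⟨α, hint⟩, rfl⟩
  refine ⟨x.den * y.den, x.num * y.den + y.num * x.den * α', by simp, ?_⟩
  have hx : (x : K) * x.den = x.num := by exact_mod_cast Rat.mul_den_eq_num x
  have hy : (y : K) * y.den = y.num := by exact_mod_cast Rat.mul_den_eq_num y
  simp only [map_add, map_mul, map_intCast, map_natCast, hα']
  push_cast
  linear_combination -(y.den : K) * hx - (x.den : K) * α * hy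

theorem map_pos_of_rat_sq_sub_pos {a : ℤ} {K : Type*} [Field K]
    [CharZero K] {α : K} (hα : α ^ 2 = (a : K)) {x y : ℚ} (hx : 0 ≤ x)
    (h : 0 < x ^ 2 - (a : ℚ) * y ^ 2) (φ : K →+* ℝ) : 0 < φ (x + y * α) := by
  have hr : φ α ^ 2 = a := by rw [← map_pow, hα, map_intCast]
  have hx' : (0 : ℝ) ≤ x := by exact_mod_cast hx
  have h' : (0 : ℝ) < (x : ℝ) ^ 2 - a * (y : ℝ) ^ 2 := by exact_mod_cast h
  rw [map_add, map_mul, map_ratCast, map_ratCast]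
  have := abs_lt_of_sq_lt_sq (a := (y : ℝ) * φ α) (b := x) (by rw [mul_pow, hr]; linarith) hx'
  linarith [neg_abs_le ((y : ℝ) * φ α)]

/-- If a prime `p` (not dividing the discriminant of `k = ℚ(√a)`, `a` squarefree `≠ 1`)
is rationally represented by `x² − a·y²`, then `p` splits in `k` as `p = 𝔭𝔭'` and `𝔭` is
equivalent, in the narrow (strict) sense, to the square of a fractional ideal. -/
theorem rational_representation_implies_principal_genus
    (a : ℤ) (ha : Squarefree a) (ha1 : a ≠ 1)
    (K : Type*) [Field K] [NumberField K] (α : K) (hα : α ^ 2 = (a : K))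
    (hgen : Algebra.adjoin ℚ {α} = ⊤)
    (p : ℕ) (hp : p.Prime) (hpd : ¬ (p : ℤ) ∣ NumberField.discr K)
    (hrep : ∃ x y : ℚ, (p : ℚ) = x ^ 2 - (a : ℚ) * y ^ 2) :
    ∃ 𝔭 𝔭' : Ideal (𝓞 K), 𝔭.IsPrime ∧ 𝔭'.IsPrime ∧
      Ideal.span {(p : 𝓞 K)} = 𝔭 * 𝔭' ∧
      ∃ (𝔟 : FractionalIdeal (𝓞 K)⁰ K) (γ : K), γ ≠ 0 ∧
        (∀ φ : K →+* ℝ, 0 < φ γ) ∧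
        (𝔭 : FractionalIdeal (𝓞 K)⁰ K) = FractionalIdeal.spanSingleton (𝓞 K)⁰ γ * 𝔟 ^ 2 := by
  obtain ⟨x, y, hx, hxy⟩ : ∃ x y : ℚ, 0 ≤ x ∧ (p : ℚ) = x ^ 2 - (a : ℚ) * y ^ 2 := by
    obtain ⟨x, y, hxy⟩ := hrep
    exact ⟨|x|, y, abs_nonneg x, by rwa [sq_abs]⟩
  obtain ⟨σ, hσα, hσσ, hσfix⟩ := exists_conj_of_adjoin_sqrt ha ha1 hα hgen
  obtain ⟨m, l, hm, hl⟩ := exists_nat_mul_add_mul_mem_ringOfIntegers hα x y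
  have hpos : (0 : ℚ) < x ^ 2 - (a : ℚ) * y ^ 2 := hxy ▸ Nat.cast_pos.mpr hp.pos
  let s : 𝓞 K ≃+* 𝓞 K := RingOfIntegers.mapRingEquiv σ.toRingEquiv
  have hsval (z : 𝓞 K) : ((s z : 𝓞 K) : K) = σ z := rfl
  have hs (z : 𝓞 K) : s (s z) = z := RingOfIntegers.ext (by rw [hsval, hsval, hσσ])
  have hfix (z : 𝓞 K) (hz : s z = z) : ∃ k : ℤ, z = k := by
    obtain ⟨q, hq⟩ := hσfix z (by rw [← hsval, hz])
    have hqint : IsIntegral ℤ q := by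
      rw [← isIntegral_algebraMap_iff (algebraMap ℚ K).injective]
      simpa [← hq] using z.isIntegral_coe
    obtain ⟨k, rfl⟩ := IsIntegrallyClosed.isIntegral_iff.mp hqint
    exact ⟨k, RingOfIntegers.ext (by simpa using hq)⟩
  have hpK : (p : K) = x ^ 2 - (a : K) * y ^ 2 := by exact_mod_cast congrArg (Rat.cast (K := K)) hxy
  have hls : l * s l = p * (m : 𝓞 K) ^ 2 := by
    apply RingOfIntegers.ext
    simp only [map_mul, map_pow, map_natCast, hsval, hl, map_add, map_ratCast, hσα, hpK]
    linear_combination (-(m : K) ^ 2 * y ^ 2) * hα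
  obtain ⟨P, hPprime, hP⟩ := exists_isPrime_span_eq_mul_map s hs hfix hp
    (Nat.cast_ne_zero.mpr hm) hls
  obtain ⟨n, C, hn, hC, hCeq⟩ := exists_span_eq_mul_sq s hs hfix hp.ne_zero hm hls hP
  have hβ : (x + y * α : K) ≠ 0 := by
    intro h0
    rw [h0, mul_zero] at hl
    have : l = 0 := RingOfIntegers.ext (by simpa using hl)
    simp [this, hp.ne_zero, hm] at hls
  have hmK : (m : K) ≠ 0 := Nat.cast_ne_zero.mpr hm
  have hnK : (n : K) ≠ 0 := Nat.cast_ne_zero.mpr hn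
  refine ⟨P, P.map s, hPprime, Ideal.map_isPrime_of_equiv s, hP,
    (C : FractionalIdeal (𝓞 K)⁰ K)⁻¹, (x + y * α) * n, mul_ne_zero hβ hnK, fun φ => ?_, ?_⟩
  · rw [map_mul, map_natCast]
    exact mul_pos (map_pos_of_rat_sq_sub_pos hα hx hpos φ) (Nat.cast_pos.mpr (Nat.pos_of_ne_zero hn))
  · have hC' : (C : FractionalIdeal (𝓞 K)⁰ K) ≠ 0 := FractionalIdeal.coeIdeal_ne_zero.mpr hC
    have hm' : FractionalIdeal.spanSingleton (𝓞 K)⁰ (m : K) ≠ 0 :=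
      FractionalIdeal.spanSingleton_ne_zero_iff.mpr hmK
    have hfrac := congrArg (fun I : Ideal (𝓞 K) => (I : FractionalIdeal (𝓞 K)⁰ K)) hCeq
    simp only [FractionalIdeal.coeIdeal_mul, FractionalIdeal.coeIdeal_pow,
      FractionalIdeal.coeIdeal_span_singleton, map_mul, map_natCast, hl] at hfrac
    rw [mul_assoc, ← FractionalIdeal.spanSingleton_mul_spanSingleton, mul_assoc] at hfrac
    rw [mul_left_cancel₀ hm' hfrac, inv_pow, mul_assoc, mul_inv_cancel₀ (pow_ne_zero 2 hC'),
      mul_one]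
end

section
/- For the quadratic Hilbert symbol over ℚ and nonzero rationals a, b, the product over all places v (including ∞) of (a, b)_v equals 1. -/
open scoped Classical

/-- The quadratic Hilbert symbol of `a, b ∈ ℚ×` at the finite place `p`:
`+1` if `a·x² + b·y² = 1` has a solution in `ℚ_p`, and `−1` otherwise. -/
noncomputable def hilbertSymbolFin (a b : ℚ) (p : ℕ) (hp : p.Prime) : ℤ :=
  haveI : Fact p.Prime := ⟨hp⟩
  if ∃ x y : ℚ_[p], a * x ^ 2 + b * y ^ 2 = 1 then 1 else -1

/-- The quadratic Hilbert symbol of `a, b ∈ ℚ×` at the infinite place. -/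
noncomputable def hilbertSymbolReal (a b : ℚ) : ℤ :=
  if ∃ x y : ℝ, a * x ^ 2 + b * y ^ 2 = 1 then 1 else -1

/-- The quadratic Hilbert symbol of `a` and `b` over the field `K`. -/
noncomputable def hilbertSymbol {K : Type*} [Field K] (a b : K) : ℤ :=
  if ∃ x y : K, a * x ^ 2 + b * y ^ 2 = 1 then 1 else -1

namespace hilbertSymbol

section Field

variable {K : Type*} [Field K]

theorem eq_one_iff {a b : K} :
    hilbertSymbol a b = 1 ↔ ∃ x y : K, a * x ^ 2 + b * y ^ 2 = 1 := by
  unfold hilbertSymbol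
  split_ifs with h <;> simp [h]

theorem eq_one_or (a b : K) : hilbertSymbol a b = 1 ∨ hilbertSymbol a b = -1 := by
  unfold hilbertSymbol
  split_ifs <;> simp

theorem congr {L : Type*} [Field L] {a b : K} {c d : L}
    (h : hilbertSymbol a b = 1 ↔ hilbertSymbol c d = 1) :
    hilbertSymbol a b = hilbertSymbol c d := by
  rcases eq_one_or a b with h1 | h1 <;> rcases eq_one_or c d with h2 | h2 <;> simp_all

theorem comm (a b : K) : hilbertSymbol a b = hilbertSymbol b a := by
  apply congr
  rw [eq_one_iff, eq_one_iff]
  constructor <;> rintro ⟨x, y, h⟩ <;> exact ⟨y, x, by rw [← h, add_comm]⟩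

theorem mul_sq_right (a b : K) {c : K} (hc : c ≠ 0) :
    hilbertSymbol a (b * c ^ 2) = hilbertSymbol a b := by
  apply congr
  rw [eq_one_iff, eq_one_iff]
  constructor
  · rintro ⟨x, y, h⟩
    exact ⟨x, c * y, by rw [← h]; ring⟩
  · rintro ⟨x, y, h⟩
    exact ⟨x, y / c, by rw [← h]; field_simp⟩

theorem mul_sq_left (a b : K) {c : K} (hc : c ≠ 0) :
    hilbertSymbol (a * c ^ 2) b = hilbertSymbol a b := by
  rw [comm, mul_sq_right _ _ hc, comm]

theorem eq_one_of_isotropic (h2 : (2 : K) ≠ 0) {a b x y z : K} (ha : a ≠ 0) (hb : b ≠ 0)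
    (h : a * x ^ 2 + b * y ^ 2 = z ^ 2) (hne : x ≠ 0 ∨ y ≠ 0 ∨ z ≠ 0) :
    hilbertSymbol a b = 1 := by
  rw [eq_one_iff]
  by_cases hz : z = 0
  · subst hz
    have hx : x ≠ 0 := by
      rintro rfl
      simp_all
    have hy : y ≠ 0 := by
      rintro rfl
      simp_all
    refine ⟨(1 + a⁻¹) / 2, (1 - a⁻¹) / 2 * (y / x), ?_⟩
    have hb' : b = - a * (x / y) ^ 2 := by
      field_simp
      linear_combination h
    rw [hb']
    field_simp
    ring
  · refine ⟨x / z, y / z, ?_⟩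
    field_simp
    exact h

theorem neg_mul_right (h2 : (2 : K) ≠ 0) {a b : K} (ha : a ≠ 0) (hb : b ≠ 0) :
    hilbertSymbol a (-(a * b)) = hilbertSymbol a b := by
  have key : ∀ c : K, c ≠ 0 → hilbertSymbol a c = 1 → hilbertSymbol a (-(a * c)) = 1 := by
    intro c hc h
    obtain ⟨x, y, h⟩ := eq_one_iff.1 h
    refine eq_one_of_isotropic h2 (x := 1) (y := y) (z := a * x) ha (by simp [ha, hc]) ?_ (by simp)
    linear_combination (-a) * h
  refine congr ⟨fun h ↦ ?_, key b hb⟩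
  have := key _ (by simp [ha, hb]) h
  rwa [show -(a * -(a * b)) = b * a ^ 2 by ring, mul_sq_right _ _ ha] at this

theorem self (h2 : (2 : K) ≠ 0) {a : K} (ha : a ≠ 0) :
    hilbertSymbol a a = hilbertSymbol a (-1) := by
  rw [← neg_mul_right h2 ha ha, show -(a * a) = -1 * a ^ 2 by ring, mul_sq_right _ _ ha]

theorem eq_one_of_isSquare {a : K} (b : K) (ha : a ≠ 0) (h : IsSquare a) :
    hilbertSymbol a b = 1 := by
  obtain ⟨r, rfl⟩ := h
  have hr : r ≠ 0 := by rintro rfl; simp at ha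
  exact eq_one_iff.2 ⟨r⁻¹, 0, by field_simp; ring⟩

theorem eq_one_of_isSquare_add (h2 : (2 : K) ≠ 0) {a b : K} (ha : a ≠ 0) (hb : b ≠ 0) (x y : K)
    (hne : x ≠ 0 ∨ y ≠ 0) (h : IsSquare (a * x ^ 2 + b * y ^ 2)) :
    hilbertSymbol a b = 1 := by
  obtain ⟨r, h⟩ := h
  exact eq_one_of_isotropic h2 (z := r) ha hb (by rw [h, sq]) (by tauto)

end Field

theorem real_eq_one_iff {a b : ℝ} (ha : a ≠ 0) (hb : b ≠ 0) :
    hilbertSymbol a b = 1 ↔ 0 < a ∨ 0 < b := by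
  constructor
  · intro h
    obtain ⟨x, y, h⟩ := eq_one_iff.1 h
    by_contra! hc
    nlinarith [sq_nonneg x, sq_nonneg y, mul_nonneg (neg_nonneg.2 hc.1) (sq_nonneg x),
      mul_nonneg (neg_nonneg.2 hc.2) (sq_nonneg y)]
  · rintro (h | h)
    · exact eq_one_of_isSquare _ ha ⟨√a, (Real.mul_self_sqrt h.le).symm⟩
    · rw [comm]
      exact eq_one_of_isSquare _ hb ⟨√b, (Real.mul_self_sqrt h.le).symm⟩

theorem real_mul_right {a b c : ℝ} (ha : a ≠ 0) (hb : b ≠ 0) (hc : c ≠ 0) :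
    hilbertSymbol a (b * c) = hilbertSymbol a b * hilbertSymbol a c := by
  have h1 := real_eq_one_iff ha hb
  have h2 := real_eq_one_iff ha hc
  have h3 := real_eq_one_iff ha (mul_ne_zero hb hc)
  rcases ha.lt_or_gt with ha' | ha'
  · rcases hb.lt_or_gt with hb' | hb' <;> rcases hc.lt_or_gt with hc' | hc' <;>
    rcases eq_one_or a b with h4 | h4 <;> rcases eq_one_or a c with h5 | h5 <;>
    rcases eq_one_or a (b * c) with h6 | h6 <;>
    simp_all [mul_pos_iff, not_lt.2 ha'.le, not_lt.2 hb'.le, not_lt.2 hc'.le]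
  · simp_all

section Padic

variable {p : ℕ} [Fact p.Prime]

theorem exists_primitive {a b : ℚ_[p]} (h : hilbertSymbol a b = 1) :
    ∃ x y z : ℤ_[p], a * x ^ 2 + b * y ^ 2 = z ^ 2 ∧ (x = 1 ∨ y = 1 ∨ z = 1) := by
  obtain ⟨x, y, h⟩ := eq_one_iff.1 h
  by_cases h1 : ‖x‖ ≤ 1 ∧ ‖y‖ ≤ 1
  · exact ⟨⟨x, h1.1⟩, ⟨y, h1.2⟩, 1, by simp [h], by simp⟩
  rcases le_total ‖x‖ ‖y‖ with hxy | hxy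
  · have hy : 1 < ‖y‖ := by grind
    have hy0 : y ≠ 0 := by rintro rfl; norm_num at hy
    refine ⟨⟨x / y, ?_⟩, 1, ⟨y⁻¹, ?_⟩, ?_, by simp⟩
    · rw [norm_div]; exact div_le_one_of_le₀ hxy (norm_nonneg _)
    · rw [norm_inv]; exact inv_le_one_of_one_le₀ hy.le
    · simp; field_simp; linear_combination h
  · have hx : 1 < ‖x‖ := by grind
    have hx0 : x ≠ 0 := by rintro rfl; norm_num at hx
    refine ⟨1, ⟨y / x, ?_⟩, ⟨x⁻¹, ?_⟩, ?_, by simp⟩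
    · rw [norm_div]; exact div_le_one_of_le₀ hxy (norm_nonneg _)
    · rw [norm_inv]; exact inv_le_one_of_one_le₀ hx.le
    · simp; field_simp; exact h


theorem exists_primitive_int {a b : ℤ} (h : hilbertSymbol (a : ℚ_[p]) b = 1) :
    ∃ x y z : ℤ_[p], a * x ^ 2 + b * y ^ 2 = z ^ 2 ∧ (x = 1 ∨ y = 1 ∨ z = 1) := by
  obtain ⟨x, y, z, h, h'⟩ := exists_primitive h
  exact ⟨x, y, z, Subtype.ext (by push_cast; exact h), h'⟩

theorem intCast_ne_zero {u : ℤ} (hu : ¬ (p : ℤ) ∣ u) : (u : ℚ_[p]) ≠ 0 := by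
  rw [Int.cast_ne_zero]
  rintro rfl
  simp at hu

theorem isSquare_of_hensel {n : ℤ} {r : ℤ_[p]} (h : ‖r ^ 2 - n‖ < ‖2 * r‖ ^ 2) :
    IsSquare (n : ℚ_[p]) := by
  obtain ⟨z, hz, -⟩ := hensels_lemma (p := p) (R := ℤ_[p])
    (F := Polynomial.X ^ 2 - Polynomial.C (n : ℤ_[p])) (a := r)
    (by simpa [one_add_one_eq_two] using h)
  refine ⟨z, ?_⟩
  have hz : z ^ 2 - n = 0 := by simpa using hz
  have : (n : ℤ_[p]) = z * z := by linear_combination -hz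
  exact_mod_cast congrArg ((↑) : ℤ_[p] → ℚ_[p]) this

theorem isSquare_of_zmod (hp : p ≠ 2) {n : ℤ} (hn : ¬ (p : ℤ) ∣ n)
    (h : IsSquare (n : ZMod p)) : IsSquare (n : ℚ_[p]) := by
  obtain ⟨r, hr⟩ := h
  obtain ⟨r, rfl⟩ := ZMod.intCast_surjective r
  have hd : (p : ℤ) ∣ r ^ 2 - n := by
    rw [← ZMod.intCast_zmod_eq_zero_iff_dvd]
    push_cast
    rw [hr]
    ring
  have hP := Nat.prime_iff_prime_int.1 (Fact.out : p.Prime)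
  have hr' : ¬ (p : ℤ) ∣ 2 * r := by
    intro hc
    rcases hP.dvd_or_dvd hc with hc | hc
    · exact hp ((Nat.prime_dvd_prime_iff_eq Fact.out Nat.prime_two).1 (by exact_mod_cast hc))
    · exact hn ((dvd_sub_right (hc.pow two_ne_zero)).1 hd)
  apply isSquare_of_hensel (r := r)
  have h1 : ‖((2 * r : ℤ) : ℤ_[p])‖ = 1 :=
    le_antisymm (PadicInt.norm_le_one _) (not_lt.1 (mt PadicInt.norm_intCast_lt_one_iff.1 hr'))
  have h2 := PadicInt.norm_intCast_lt_one_iff.2 hd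
  push_cast at h1 h2
  rw [h1]
  simpa using h2

theorem padic_unit_unit (hp : p ≠ 2) {u v : ℤ} (hu : ¬ (p : ℤ) ∣ u) (hv : ¬ (p : ℤ) ∣ v) :
    hilbertSymbol (u : ℚ_[p]) v = 1 := by
  have hu' : (u : ZMod p) ≠ 0 := by rwa [Ne, ZMod.intCast_zmod_eq_zero_iff_dvd]
  have hv' : (v : ZMod p) ≠ 0 := by rwa [Ne, ZMod.intCast_zmod_eq_zero_iff_dvd]
  obtain ⟨x, y, hxy⟩ := FiniteField.exists_root_sum_quadratic (R := ZMod p)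
    (f := Polynomial.C (u : ZMod p) * Polynomial.X ^ 2)
    (g := Polynomial.C (v : ZMod p) * Polynomial.X ^ 2 + Polynomial.C (-1))
    (by compute_degree!) (by compute_degree!)
    (by rw [ZMod.card]; exact (Nat.Prime.odd_of_ne_two Fact.out hp |> Nat.odd_iff.1))
  obtain ⟨x, rfl⟩ := ZMod.intCast_surjective x
  obtain ⟨y, rfl⟩ := ZMod.intCast_surjective y
  have h1 : ((u * x ^ 2 + v * y ^ 2 : ℤ) : ZMod p) = 1 := by
    simp at hxy
    push_cast
    linear_combination hxy
  have h2 := isSquare_of_zmod hp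
    (by rw [← ZMod.intCast_zmod_eq_zero_iff_dvd, h1]; exact one_ne_zero) (h1 ▸ IsSquare.one)
  push_cast at h2
  refine eq_one_of_isSquare_add two_ne_zero (intCast_ne_zero hu) (intCast_ne_zero hv) x y ?_ h2
  by_contra! hc
  simp only [Int.cast_eq_zero] at hc
  simp [hc] at h1

theorem padic_unit_uniformizer (hp : p ≠ 2) {u v : ℤ} (hu : ¬ (p : ℤ) ∣ u)
    (hv : ¬ (p : ℤ) ∣ v) :
    hilbertSymbol (u : ℚ_[p]) (p * v) = legendreSym p u := by
  have hu' : (u : ZMod p) ≠ 0 := by rwa [Ne, ZMod.intCast_zmod_eq_zero_iff_dvd]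
  have hP : Prime (p : ℤ_[p]) := PadicInt.prime_p
  have key : hilbertSymbol (u : ℚ_[p]) (p * v) = 1 ↔ legendreSym p u = 1 := by
    rw [legendreSym.eq_one_iff p hu']
    constructor
    · intro h
      obtain ⟨x, y, z, h, h'⟩ := exists_primitive_int (p := p) (a := u) (b := p * v) (by simpa using h)
      have hmod := congrArg (PadicInt.toZMod (p := p)) h
      have hker : ∀ t : ℤ_[p], PadicInt.toZMod t = 0 ↔ (p : ℤ_[p]) ∣ t := by
        intro t
        rw [← RingHom.mem_ker, PadicInt.ker_toZMod, PadicInt.maximalIdeal_eq_span_p,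
          Ideal.mem_span_singleton]
      simp at hmod
      by_cases hx : PadicInt.toZMod x = 0
      · have hz : PadicInt.toZMod z = 0 := by simpa [hx] using hmod.symm
        rw [hker] at hx hz
        obtain ⟨x, rfl⟩ := hx
        obtain ⟨z, rfl⟩ := hz
        have hy : (v : ℤ_[p]) * y ^ 2 = p * (z ^ 2 - u * x ^ 2) := by
          apply mul_left_cancel₀ hP.ne_zero
          push_cast at h
          linear_combination h
        have hv' : ¬ (p : ℤ_[p]) ∣ v := by
          rw [← hker, map_intCast, ZMod.intCast_zmod_eq_zero_iff_dvd]
          exact hv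
        have hy : (p : ℤ_[p]) ∣ y :=
          hP.dvd_of_dvd_pow ((hP.dvd_or_dvd ⟨_, hy⟩).resolve_left hv')
        exfalso
        rcases h' with h' | h' | h'
        · exact hP.not_isUnit (.of_mul_eq_one _ h')
        · exact hP.not_isUnit (isUnit_of_dvd_one (h' ▸ hy))
        · exact hP.not_isUnit (.of_mul_eq_one _ h')
      · refine ⟨PadicInt.toZMod z / PadicInt.toZMod x, ?_⟩
        field_simp
        exact hmod
    · intro h
      exact eq_one_of_isSquare _ (intCast_ne_zero hu) (isSquare_of_zmod hp hu h)
  rcases eq_one_or (u : ℚ_[p]) (p * v) with h | h <;>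
    rcases legendreSym.eq_one_or_neg_one p hu' with h' | h' <;> simp_all

theorem padic_formula (hp : p ≠ 2) {u v : ℤ} (hu : ¬ (p : ℤ) ∣ u) (hv : ¬ (p : ℤ) ∣ v)
    (m n : ℕ) :
    hilbertSymbol ((p : ℚ_[p]) ^ m * u) (p ^ n * v) =
      legendreSym p (-1) ^ (m * n) * legendreSym p u ^ n * legendreSym p v ^ m := by
  have hp0 : (p : ℚ_[p]) ≠ 0 := by exact_mod_cast (Fact.out : p.Prime).ne_zero
  have hu' : (u : ZMod p) ≠ 0 := by rwa [Ne, ZMod.intCast_zmod_eq_zero_iff_dvd]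
  have hv' : (v : ZMod p) ≠ 0 := by rwa [Ne, ZMod.intCast_zmod_eq_zero_iff_dvd]
  have h1 : ((-1 : ℤ) : ZMod p) ≠ 0 := by simp
  have hsq : ∀ (t : ℚ_[p]) (k : ℕ), (p : ℚ_[p]) ^ (k + k) * t = t * (p ^ k) ^ 2 := by
    intros; ring
  have hsq' : ∀ (t : ℚ_[p]) (k : ℕ), (p : ℚ_[p]) ^ (2 * k + 1) * t = p * t * (p ^ k) ^ 2 := by
    intros; ring
  have hk : ∀ k, (p : ℚ_[p]) ^ k ≠ 0 := fun k ↦ pow_ne_zero _ hp0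
  have e1 := legendreSym.sq_one p h1
  have e2 := legendreSym.sq_one p hu'
  have e3 := legendreSym.sq_one p hv'
  rcases Nat.even_or_odd' m with ⟨k, rfl | rfl⟩ <;> rcases Nat.even_or_odd' n with ⟨l, rfl | rfl⟩
  · rw [two_mul, two_mul, hsq, hsq, mul_sq_left _ _ (hk k), mul_sq_right _ _ (hk l),
      padic_unit_unit hp hu hv, ← two_mul, ← two_mul, mul_assoc 2]
    simp only [pow_mul, e1, e2, e3, one_pow, mul_one]
  · rw [two_mul, hsq, hsq', mul_sq_left _ _ (hk k), mul_sq_right _ _ (hk l),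
      padic_unit_uniformizer hp hu hv, ← two_mul, mul_assoc 2]
    simp only [pow_mul, pow_succ _ (2 * l), e1, e2, e3, one_pow, mul_one, one_mul]
  · rw [two_mul l, hsq, hsq', mul_sq_left _ _ (hk k), mul_sq_right _ _ (hk l), comm,
      padic_unit_uniformizer hp hv hu, ← two_mul, mul_comm _ (2 * l), mul_assoc 2]
    simp only [pow_mul, pow_succ _ (2 * k), e1, e2, e3, one_pow, mul_one, one_mul]
  · rw [hsq', hsq', mul_sq_left _ _ (hk k), mul_sq_right _ _ (hk l),
      ← neg_mul_right two_ne_zero (mul_ne_zero hp0 (intCast_ne_zero hu))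
        (mul_ne_zero hp0 (intCast_ne_zero hv)),
      show -((p : ℚ_[p]) * u * (p * v)) = ((-1 * u * v : ℤ) : ℚ_[p]) * p ^ 2 by push_cast; ring,
      mul_sq_right _ _ hp0, comm, padic_unit_uniformizer hp _ hu, legendreSym.mul, legendreSym.mul]
    · rw [show (2 * k + 1) * (2 * l + 1) = 2 * (2 * k * l + k + l) + 1 by ring]
      simp only [pow_mul, pow_succ _ (2 * _), e1, e2, e3, one_pow, one_mul]
    · rw [← ZMod.intCast_zmod_eq_zero_iff_dvd]
      push_cast
      simp_all

theorem exists_decomp {a : ℤ} (ha : a ≠ 0) : ∃ (m : ℕ) (u : ℤ), ¬ (p : ℤ) ∣ u ∧ a = p ^ m * u := by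
  have hP := Nat.prime_iff_prime_int.1 (Fact.out : p.Prime)
  obtain ⟨u, h1, h2⟩ := (FiniteMultiplicity.of_prime_left hP ha).exists_eq_pow_mul_and_not_dvd
  exact ⟨_, u, h2, h1⟩

theorem padic_mul_right_of_ne_two (hp : p ≠ 2) {a b c : ℤ} (ha : a ≠ 0) (hb : b ≠ 0) (hc : c ≠ 0) :
    hilbertSymbol (a : ℚ_[p]) (b * c) =
      hilbertSymbol (a : ℚ_[p]) b * hilbertSymbol (a : ℚ_[p]) c := by
  have hP := Nat.prime_iff_prime_int.1 (Fact.out : p.Prime)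
  obtain ⟨k, u, hu, rfl⟩ := exists_decomp (p := p) ha
  obtain ⟨m, v, hv, rfl⟩ := exists_decomp (p := p) hb
  obtain ⟨n, w, hw, rfl⟩ := exists_decomp (p := p) hc
  have hvw : ¬ (p : ℤ) ∣ v * w := fun h ↦ (hP.dvd_or_dvd h).elim hv hw
  push_cast
  rw [show (p : ℚ_[p]) ^ m * v * (p ^ n * w) = p ^ (m + n) * ((v * w : ℤ) : ℚ_[p]) by
      push_cast; ring,
    padic_formula hp hu hvw, padic_formula hp hu hv, padic_formula hp hu hw, legendreSym.mul]
  ring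

end Padic

section Dyadic

open ZMod

/-- The sign `(-1) ^ ((x - 1) / 2 * ((y - 1) / 2))` for odd residues `x`, `y` modulo `8`. -/
def oddSign (x y : ZMod 8) : ℤ := if (x = 3 ∨ x = 7) ∧ (y = 3 ∨ y = 7) then -1 else 1

theorem oddSign_eq_one_or (x y : ZMod 8) : oddSign x y = 1 ∨ oddSign x y = -1 := by
  unfold oddSign
  split_ifs <;> simp

theorem oddSign_mul_right : ∀ u : ZMod 8, u ^ 2 = 1 → ∀ v : ZMod 8, v ^ 2 = 1 →
    ∀ w : ZMod 8, w ^ 2 = 1 → oddSign u (v * w) = oddSign u v * oddSign u w := by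
  decide +kernel

theorem χ₈_sq : ∀ u : ZMod 8, u ^ 2 = 1 → χ₈ u ^ 2 = 1 := by
  decide +kernel

theorem oddSign_natCast {m n : ℕ} (hm : m % 2 = 1) (hn : n % 2 = 1) :
    oddSign m n = (-1) ^ (m / 2 * (n / 2)) := by
  have key : ∀ k : ℕ, k % 2 = 1 → (((k : ZMod 8) = 3 ∨ (k : ZMod 8) = 7) ↔ Odd (k / 2)) := by
    intro k hk
    have h3 := ZMod.natCast_eq_natCast_iff' k 3 8
    have h7 := ZMod.natCast_eq_natCast_iff' k 7 8
    push_cast at h3 h7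
    rw [h3, h7, Nat.odd_iff]
    omega
  simp only [oddSign, key m hm, key n hn]
  split_ifs with h
  · rw [(Nat.odd_mul.2 h).neg_one_pow]
  · rw [(Nat.not_odd_iff_even.1 (mt Nat.odd_mul.1 h)).neg_one_pow]

theorem intCast_sq_eq_one {u : ℤ} (hu : ¬ (2 : ℤ) ∣ u) : (u : ZMod 8) ^ 2 = 1 := by
  have key : ∀ x : ZMod 8, x * 4 ≠ 0 → x ^ 2 = 1 := by decide +kernel
  apply key
  intro h
  have : ((u * 4 : ℤ) : ZMod 8) = 0 := by push_cast; exact h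
  rw [ZMod.intCast_zmod_eq_zero_iff_dvd] at this
  push_cast at this
  omega

theorem isSquare_dyadic {n : ℤ} (h : (n : ZMod 8) = 1) : IsSquare (n : ℚ_[2]) := by
  have hd : (2 ^ 3 : ℤ) ∣ 1 - n := by
    have : ((1 - n : ℤ) : ZMod 8) = 0 := by push_cast; rw [h, sub_self]
    exact_mod_cast (ZMod.intCast_zmod_eq_zero_iff_dvd _ 8).1 this
  apply isSquare_of_hensel (r := 1)
  have h1 := (PadicInt.norm_int_le_pow_iff_dvd (p := 2) (k := 1 - n) (n := 3)).2
    (by exact_mod_cast hd)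
  have h2 : ‖(2 : ℤ_[2])‖ = 2⁻¹ := by exact_mod_cast PadicInt.norm_p (p := 2)
  push_cast at h1
  rw [one_pow, mul_one, h2]
  refine h1.trans_lt ?_
  norm_num

/-- A solution over `ℚ_[2]` reduces to a solution modulo `8` with a coordinate equal to `1`. -/
theorem exists_mod_eight {a b : ℤ} (h : hilbertSymbol (a : ℚ_[2]) b = 1) :
    ∃ x y : ZMod 8, a * x ^ 2 + b * y ^ 2 = 1 ∨ a + b * x ^ 2 = y ^ 2 ∨ a * x ^ 2 + b = y ^ 2 := by
  obtain ⟨x, y, z, h, h'⟩ := exists_primitive_int h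
  let f : ℤ_[2] →+* ZMod 8 := PadicInt.toZModPow 3
  have hf := congrArg f h
  simp only [map_add, map_mul, map_pow, map_intCast] at hf
  rcases h' with rfl | rfl | rfl
  · exact ⟨f y, f z, .inr (.inl (by simpa using hf))⟩
  · exact ⟨f x, f z, .inr (.inr (by simpa using hf))⟩
  · exact ⟨f x, f y, .inl (by simpa using hf)⟩

theorem dyadic_unit_unit {u v : ℤ} (hu : ¬ (2 : ℤ) ∣ u) (hv : ¬ (2 : ℤ) ∣ v) :
    hilbertSymbol (u : ℚ_[2]) v = oddSign u v := by
  have hu0 : (u : ℚ_[2]) ≠ 0 := intCast_ne_zero hu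
  have hv0 : (v : ℚ_[2]) ≠ 0 := intCast_ne_zero hv
  have key : hilbertSymbol (u : ℚ_[2]) v = 1 ↔ oddSign u v = 1 := by
    constructor
    · intro h
      have necessity : ∀ u : ZMod 8, u ^ 2 = 1 → ∀ v : ZMod 8, v ^ 2 = 1 → ∀ x y : ZMod 8,
          (u * x ^ 2 + v * y ^ 2 = 1 ∨ u + v * x ^ 2 = y ^ 2 ∨ u * x ^ 2 + v = y ^ 2) →
          oddSign u v = 1 := by
        decide +kernel
      obtain ⟨x, y, h⟩ := exists_mod_eight h
      exact necessity _ (intCast_sq_eq_one hu) _ (intCast_sq_eq_one hv) x y h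
    · intro h
      have sufficiency : ∀ u : ZMod 8, u ^ 2 = 1 → ∀ v : ZMod 8, v ^ 2 = 1 →
          oddSign u v = 1 → u = 1 ∨ u + v * 4 = 1 ∨ v = 1 ∨ u * 4 + v = 1 := by
        decide +kernel
      rcases sufficiency _ (intCast_sq_eq_one hu) _ (intCast_sq_eq_one hv) h with h | h | h | h
      · exact eq_one_of_isSquare _ hu0 (isSquare_dyadic h)
      · have := isSquare_dyadic (n := u * 1 ^ 2 + v * 2 ^ 2) (by push_cast; linear_combination h)
        exact eq_one_of_isSquare_add two_ne_zero hu0 hv0 1 2 (by simp) (by exact_mod_cast this)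
      · rw [comm]
        exact eq_one_of_isSquare _ hv0 (isSquare_dyadic h)
      · have := isSquare_dyadic (n := u * 2 ^ 2 + v * 1 ^ 2) (by push_cast; linear_combination h)
        exact eq_one_of_isSquare_add two_ne_zero hu0 hv0 2 1 (by simp) (by exact_mod_cast this)
  rcases eq_one_or (u : ℚ_[2]) v with h | h <;>
    rcases oddSign_eq_one_or u v with h' | h' <;> simp_all

theorem dyadic_unit_uniformizer {u v : ℤ} (hu : ¬ (2 : ℤ) ∣ u) (hv : ¬ (2 : ℤ) ∣ v) :
    hilbertSymbol (u : ℚ_[2]) (2 * v) = χ₈ u * oddSign u v := by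
  have hu0 : (u : ℚ_[2]) ≠ 0 := intCast_ne_zero hu
  have hv0 : (2 * v : ℚ_[2]) ≠ 0 := mul_ne_zero two_ne_zero (intCast_ne_zero hv)
  have key : hilbertSymbol (u : ℚ_[2]) (2 * v) = 1 ↔ χ₈ u * oddSign u v = 1 := by
    constructor
    · intro h
      have necessity : ∀ u : ZMod 8, u ^ 2 = 1 → ∀ v : ZMod 8, v ^ 2 = 1 → ∀ x y : ZMod 8,
          (u * x ^ 2 + 2 * v * y ^ 2 = 1 ∨ u + 2 * v * x ^ 2 = y ^ 2 ∨
            u * x ^ 2 + 2 * v = y ^ 2) → χ₈ u * oddSign u v = 1 := by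
        decide +kernel
      obtain ⟨x, y, h⟩ := exists_mod_eight (b := 2 * v) (by exact_mod_cast h)
      push_cast at h
      exact necessity _ (intCast_sq_eq_one hu) _ (intCast_sq_eq_one hv) x y h
    · intro h
      have sufficiency : ∀ u : ZMod 8, u ^ 2 = 1 → ∀ v : ZMod 8, v ^ 2 = 1 →
          χ₈ u * oddSign u v = 1 → u = 1 ∨ u + 2 * v = 1 := by
        decide +kernel
      rcases sufficiency _ (intCast_sq_eq_one hu) _ (intCast_sq_eq_one hv) h with h | h
      · exact eq_one_of_isSquare _ hu0 (isSquare_dyadic h)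
      · have := isSquare_dyadic (n := u * 1 ^ 2 + 2 * v * 1 ^ 2) (by push_cast; linear_combination h)
        exact eq_one_of_isSquare_add two_ne_zero hu0 hv0 1 1 (by simp) (by exact_mod_cast this)
  have hχ : χ₈ (u : ZMod 8) = 1 ∨ χ₈ (u : ZMod 8) = -1 :=
    mul_self_eq_one_iff.1 (by rw [← sq, χ₈_sq _ (intCast_sq_eq_one hu)])
  rcases eq_one_or (u : ℚ_[2]) (2 * v) with h | h <;> rcases hχ with h'' | h'' <;>
    rcases oddSign_eq_one_or u v with h' | h' <;> simp_all

theorem dyadic_formula {u v : ℤ} (hu : ¬ (2 : ℤ) ∣ u) (hv : ¬ (2 : ℤ) ∣ v) (m n : ℕ) :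
    hilbertSymbol ((2 : ℚ_[2]) ^ m * u) (2 ^ n * v) =
      χ₈ u ^ n * χ₈ v ^ m * oddSign u v := by
  have hp0 : (2 : ℚ_[2]) ≠ 0 := two_ne_zero
  have hsq : ∀ (t : ℚ_[2]) (k : ℕ), (2 : ℚ_[2]) ^ (2 * k) * t = t * (2 ^ k) ^ 2 := by
    intros; ring
  have hsq' : ∀ (t : ℚ_[2]) (k : ℕ), (2 : ℚ_[2]) ^ (2 * k + 1) * t = 2 * t * (2 ^ k) ^ 2 := by
    intros; ring
  have hk : ∀ k, (2 : ℚ_[2]) ^ k ≠ 0 := fun k ↦ pow_ne_zero _ hp0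
  have e1 := χ₈_sq _ (intCast_sq_eq_one hu)
  have e2 := χ₈_sq _ (intCast_sq_eq_one hv)
  have oddSign_comm : ∀ x y, oddSign x y = oddSign y x := by
    intro x y
    simp only [oddSign, and_comm]
  rcases Nat.even_or_odd' m with ⟨k, rfl | rfl⟩ <;> rcases Nat.even_or_odd' n with ⟨l, rfl | rfl⟩
  · rw [hsq, hsq, mul_sq_left _ _ (hk k), mul_sq_right _ _ (hk l), dyadic_unit_unit hu hv]
    simp only [pow_mul, e1, e2, one_pow, one_mul]
  · rw [hsq, hsq', mul_sq_left _ _ (hk k), mul_sq_right _ _ (hk l),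
      dyadic_unit_uniformizer hu hv]
    simp only [pow_mul, pow_succ _ (2 * l), e1, e2, one_pow, mul_one, one_mul]
  · rw [hsq, hsq', mul_sq_left _ _ (hk k), mul_sq_right _ _ (hk l), comm,
      dyadic_unit_uniformizer hv hu, oddSign_comm]
    simp only [pow_mul, pow_succ _ (2 * k), e1, e2, one_pow, one_mul]
  · have hneg : ∀ u : ZMod 8, u ^ 2 = 1 → ∀ v : ZMod 8, v ^ 2 = 1 →
        χ₈ (-(u * v)) * oddSign (-(u * v)) u = χ₈ u * χ₈ v * oddSign u v := by
      decide +kernel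
    have huv : ¬ (2 : ℤ) ∣ -(u * v) := by
      rw [dvd_neg, Int.prime_two.dvd_mul]
      tauto
    rw [hsq', hsq', mul_sq_left _ _ (hk k), mul_sq_right _ _ (hk l),
      ← neg_mul_right two_ne_zero (mul_ne_zero hp0 (intCast_ne_zero hu))
        (mul_ne_zero hp0 (intCast_ne_zero hv)),
      show -((2 : ℚ_[2]) * u * (2 * v)) = ((-(u * v) : ℤ) : ℚ_[2]) * 2 ^ 2 by push_cast; ring,
      mul_sq_right _ _ hp0, comm, dyadic_unit_uniformizer huv hu]
    push_cast
    rw [hneg _ (intCast_sq_eq_one hu) _ (intCast_sq_eq_one hv)]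
    simp only [pow_mul, pow_succ _ (2 * _), e1, e2, one_pow, one_mul]

theorem dyadic_mul_right {a b c : ℤ} (ha : a ≠ 0) (hb : b ≠ 0) (hc : c ≠ 0) :
    hilbertSymbol (a : ℚ_[2]) (b * c) =
      hilbertSymbol (a : ℚ_[2]) b * hilbertSymbol (a : ℚ_[2]) c := by
  obtain ⟨k, u, hu, rfl⟩ := exists_decomp (p := 2) ha
  obtain ⟨m, v, hv, rfl⟩ := exists_decomp (p := 2) hb
  obtain ⟨n, w, hw, rfl⟩ := exists_decomp (p := 2) hc
  push_cast at hu hv hw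
  have hvw : ¬ (2 : ℤ) ∣ v * w := fun h ↦ (Int.prime_two.dvd_or_dvd h).elim hv hw
  push_cast
  rw [show (2 : ℚ_[2]) ^ m * v * (2 ^ n * w) = 2 ^ (m + n) * ((v * w : ℤ) : ℚ_[2]) by
      push_cast; ring,
    dyadic_formula hu hvw, dyadic_formula hu hv, dyadic_formula hu hw]
  push_cast
  rw [oddSign_mul_right _ (intCast_sq_eq_one hu) _ (intCast_sq_eq_one hv) _
    (intCast_sq_eq_one hw), map_mul]
  ring

end Dyadic

section Global

instance (p : Nat.Primes) : Fact (p : ℕ).Prime := ⟨p.2⟩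

theorem padic_mul_right (p : ℕ) [Fact p.Prime] {a b c : ℤ} (ha : a ≠ 0) (hb : b ≠ 0)
    (hc : c ≠ 0) :
    hilbertSymbol (a : ℚ_[p]) (b * c) =
      hilbertSymbol (a : ℚ_[p]) b * hilbertSymbol (a : ℚ_[p]) c := by
  by_cases hp : p = 2
  · subst hp
    exact dyadic_mul_right ha hb hc
  · exact padic_mul_right_of_ne_two hp ha hb hc

/-- A prime number as an element of `Nat.Primes`. -/
def place (p : ℕ) [hp : Fact p.Prime] : Nat.Primes := ⟨p, hp.out⟩

theorem eq_place_iff {p : Nat.Primes} {q : ℕ} [Fact q.Prime] : p = place q ↔ (p : ℕ) = q :=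
  Subtype.ext_iff

theorem place_inj {p q : ℕ} [Fact p.Prime] [Fact q.Prime] : place p = place q ↔ p = q :=
  eq_place_iff

theorem at_place (p : ℕ) [Fact p.Prime] (a b : ℤ) :
    hilbertSymbol (a : ℚ_[place p]) b = hilbertSymbol (a : ℚ_[p]) b :=
  rfl

/-- The product of the Hilbert symbols of two integers over all places of `ℚ`. -/
noncomputable def placesProd (a b : ℤ) : ℤ :=
  hilbertSymbol (a : ℝ) b * ∏ᶠ p : Nat.Primes, hilbertSymbol (a : ℚ_[p]) b

theorem placesProd_comm (a b : ℤ) : placesProd a b = placesProd b a := by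
  unfold placesProd
  rw [comm]
  simp only [comm (b : ℚ_[_])]

theorem placesProd_self {a : ℤ} (ha : a ≠ 0) : placesProd a a = placesProd a (-1) := by
  unfold placesProd
  push_cast
  rw [self two_ne_zero (by exact_mod_cast ha)]
  congr 1
  exact finprod_congr fun p ↦ self two_ne_zero (by exact_mod_cast ha)

theorem hasFiniteMulSupport {a b : ℤ} (ha : a ≠ 0) (hb : b ≠ 0) :
    Function.HasFiniteMulSupport fun p : Nat.Primes ↦ hilbertSymbol (a : ℚ_[p]) b := by
  have hfin : Set.Finite {p : Nat.Primes | (p : ℕ) ∣ (2 * a * b).natAbs} := by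
    apply Set.Finite.preimage Nat.Primes.coe_nat_injective.injOn (s := {n | n ∣ (2 * a * b).natAbs})
    exact (Nat.divisors (2 * a * b).natAbs).finite_toSet.subset fun n hn ↦ by
      simpa [ha, hb] using hn
  refine hfin.subset fun p hp ↦ ?_
  by_contra hc
  simp only [Set.mem_ofPred_eq, ← Int.natCast_dvd] at hc
  refine hp (padic_unit_unit (fun h ↦ hc ?_) (fun h ↦ hc ?_) (fun h ↦ hc ?_))
  · rw [h, mul_assoc]
    exact dvd_mul_right _ _
  · exact (h.mul_left 2).mul_right b
  · exact h.mul_left _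

theorem placesProd_mul_right {a b c : ℤ} (ha : a ≠ 0) (hb : b ≠ 0) (hc : c ≠ 0) :
    placesProd a (b * c) = placesProd a b * placesProd a c := by
  unfold placesProd
  push_cast
  rw [real_mul_right (by exact_mod_cast ha) (by exact_mod_cast hb) (by exact_mod_cast hc),
    finprod_congr fun p : Nat.Primes ↦ padic_mul_right p ha hb hc,
    finprod_mul_distrib (hasFiniteMulSupport ha hb) (hasFiniteMulSupport ha hc)]
  ring

theorem placesProd_eq_prod {a b : ℤ} (s : Finset Nat.Primes) (hs : place 2 ∈ s)
    (h : ∀ p : Nat.Primes, p ∉ s → ¬ ((p : ℕ) : ℤ) ∣ a ∧ ¬ ((p : ℕ) : ℤ) ∣ b) :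
    placesProd a b = hilbertSymbol (a : ℝ) b * ∏ p ∈ s, hilbertSymbol (a : ℚ_[p]) b := by
  unfold placesProd
  rw [finprod_eq_prod_of_mulSupport_subset]
  intro p hp
  by_contra hps
  refine hp (padic_unit_unit ?_ (h p hps).1 (h p hps).2)
  rintro h2
  exact hps (eq_place_iff.2 h2 ▸ hs)

theorem int_induction {P : ℤ → Prop} (neg_one : P (-1)) (prime : ∀ p : ℕ, p.Prime → P p)
    (mul : ∀ a b, a ≠ 0 → b ≠ 0 → P a → P b → P (a * b)) {n : ℤ} (hn : n ≠ 0) : P n := by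
  have one : P 1 := by simpa using mul (-1) (-1) (by simp) (by simp) neg_one neg_one
  have nat : ∀ n : ℕ, n ≠ 0 → P n := by
    intro n
    induction n using induction_on_primes with
    | zero => simp
    | one => simpa using one
    | prime_mul p n hp ih =>
      intro h
      have hn : n ≠ 0 := right_ne_zero_of_mul h
      push_cast
      exact mul _ _ (by exact_mod_cast hp.ne_zero) (by exact_mod_cast hn) (prime p hp) (ih hn)
  rcases Int.natAbs_eq n with h | h
  · rw [h]
    exact nat _ (by simpa using hn)
  · rw [h, ← neg_one_mul]
    exact mul _ _ (by simp) (by simpa using hn) neg_one (nat _ (by simpa using hn))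

theorem not_dvd_neg_one (p : ℕ) [Fact p.Prime] : ¬ (p : ℤ) ∣ -1 := by
  rw [dvd_neg]
  exact (Nat.prime_iff_prime_int.1 Fact.out).not_dvd_one

theorem not_dvd_of_ne {p q : ℕ} (hp : p.Prime) (hq : q.Prime) (h : p ≠ q) : ¬ (p : ℤ) ∣ q := by
  rw [Int.natCast_dvd_natCast, Nat.prime_dvd_prime_iff_eq hp hq]
  exact h

theorem real_eq_one_of_pos_right {a b : ℤ} (ha : a ≠ 0) (hb : 0 < b) :
    hilbertSymbol (a : ℝ) b = 1 :=
  (real_eq_one_iff (by exact_mod_cast ha) (by exact_mod_cast hb.ne')).2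
    (.inr (by exact_mod_cast hb))

theorem placesProd_neg_one_neg_one : placesProd (-1) (-1) = 1 := by
  rw [placesProd_eq_prod {place 2} (by simp)
    fun p _ ↦ ⟨not_dvd_neg_one p, not_dvd_neg_one p⟩, Finset.prod_singleton, at_place,
    dyadic_unit_unit (by norm_num) (by norm_num)]
  have hr : hilbertSymbol ((-1 : ℤ) : ℝ) ((-1 : ℤ) : ℝ) = -1 := by
    refine (eq_one_or _ _).resolve_left fun h ↦ ?_
    rw [real_eq_one_iff (by simp) (by simp)] at h
    norm_num at h
  rw [hr]
  decide +kernel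

theorem placesProd_neg_one_two : placesProd (-1) 2 = 1 := by
  have key : ∀ (K : Type) [Field K], hilbertSymbol ((-1 : ℤ) : K) ((2 : ℤ) : K) = 1 :=
    fun K _ ↦ eq_one_iff.2 ⟨1, 1, by push_cast; ring⟩
  unfold placesProd
  simp only [key, finprod_one, mul_one]

theorem not_two_dvd {q : ℕ} (hq : q.Prime) (h2 : q ≠ 2) : ¬ (2 : ℤ) ∣ q := by
  exact_mod_cast not_dvd_of_ne Nat.prime_two hq h2.symm

theorem ramified_eq_legendreSym {q : ℕ} [Fact q.Prime] (h2 : q ≠ 2) {u : ℤ}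
    (hu : ¬ (q : ℤ) ∣ u) : hilbertSymbol (u : ℚ_[q]) ((q : ℤ) : ℚ_[q]) = legendreSym q u := by
  simpa using padic_unit_uniformizer h2 hu (v := 1)
    (Nat.prime_iff_prime_int.1 Fact.out).not_dvd_one

theorem placesProd_prime_right {q : ℕ} [hq : Fact q.Prime] (h2 : q ≠ 2) {a : ℤ} (ha : a ≠ 0)
    (h : ∀ p : ℕ, p.Prime → p ≠ 2 → ¬ (p : ℤ) ∣ a) :
    placesProd a q = hilbertSymbol (a : ℚ_[2]) (q : ℤ) * legendreSym q a := by
  have hne : place 2 ≠ place q := mt place_inj.1 h2.symm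
  have hsup : ∀ p : Nat.Primes, p ∉ ({place 2, place q} : Finset Nat.Primes) →
      ¬ ((p : ℕ) : ℤ) ∣ a ∧ ¬ ((p : ℕ) : ℤ) ∣ (q : ℤ) := by
    intro p hp
    simp only [Finset.mem_insert, Finset.mem_singleton, not_or, eq_place_iff] at hp
    exact ⟨h p p.2 hp.1, not_dvd_of_ne p.2 hq.out hp.2⟩
  rw [placesProd_eq_prod _ (by simp) hsup, Finset.prod_pair hne, at_place, at_place,
    ramified_eq_legendreSym h2 (h q hq.out h2),
    real_eq_one_of_pos_right ha (by exact_mod_cast hq.out.pos), one_mul]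

theorem placesProd_neg_one_prime {q : ℕ} (hq : q.Prime) (h2 : q ≠ 2) :
    placesProd (-1) q = 1 := by
  have : Fact q.Prime := ⟨hq⟩
  rw [placesProd_prime_right h2 (by simp) fun p hp _ ↦
      have : Fact p.Prime := ⟨hp⟩
      not_dvd_neg_one p,
    legendreSym.at_neg_one h2]
  have h := dyadic_unit_unit (u := -1) (v := q) (by norm_num) (not_two_dvd hq h2)
  have hodd := hq.eq_two_or_odd.resolve_left h2
  push_cast at h ⊢
  have h7 : (-1 : ZMod 8) = (7 : ℕ) := by decide
  rw [h, h7, oddSign_natCast (by norm_num) hodd, ZMod.χ₄_eq_neg_one_pow hodd, ← pow_add]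
  exact Even.neg_one_pow ⟨2 * (q / 2), by ring⟩

theorem placesProd_two_prime {q : ℕ} (hq : q.Prime) (h2 : q ≠ 2) : placesProd 2 q = 1 := by
  have : Fact q.Prime := ⟨hq⟩
  rw [placesProd_prime_right h2 (by simp) fun p hp hp2 ↦ by
      exact_mod_cast not_dvd_of_ne hp Nat.prime_two hp2,
    legendreSym.at_two h2, comm]
  have h := dyadic_unit_uniformizer (u := q) (v := 1) (not_two_dvd hq h2) (by norm_num)
  have h1 : ∀ x, oddSign x 1 = 1 := by decide
  have hsq := χ₈_sq _ (intCast_sq_eq_one (not_two_dvd hq h2))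
  push_cast at h hsq ⊢
  rw [mul_one, h1, mul_one] at h
  rw [h, ← sq, hsq]

theorem placesProd_prime_prime {q r : ℕ} (hq : q.Prime) (hr : r.Prime) (hq2 : q ≠ 2)
    (hr2 : r ≠ 2) (hqr : q ≠ r) : placesProd q r = 1 := by
  have : Fact q.Prime := ⟨hq⟩
  have : Fact r.Prime := ⟨hr⟩
  have h := dyadic_unit_unit (not_two_dvd hq hq2) (not_two_dvd hr hr2)
  have hsup : ∀ p : Nat.Primes,
      p ∉ ({place 2, place q, place r} : Finset Nat.Primes) →
      ¬ ((p : ℕ) : ℤ) ∣ q ∧ ¬ ((p : ℕ) : ℤ) ∣ r := by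
    intro p hp
    simp only [Finset.mem_insert, Finset.mem_singleton, not_or, eq_place_iff] at hp
    exact ⟨not_dvd_of_ne p.2 hq hp.2.1, not_dvd_of_ne p.2 hr hp.2.2⟩
  have h1 : place 2 ∉ ({place q, place r} : Finset Nat.Primes) := by
    simp [place_inj, hq2.symm, hr2.symm]
  have h2 : place q ≠ place r := mt place_inj.1 hqr
  rw [placesProd_eq_prod _ (by simp) hsup, Finset.prod_insert h1, Finset.prod_pair h2,
    real_eq_one_of_pos_right (by exact_mod_cast hq.ne_zero) (by exact_mod_cast hr.pos),
    at_place, at_place, at_place, h, comm ((q : ℤ) : ℚ_[q]),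
    ramified_eq_legendreSym hq2 (not_dvd_of_ne hq hr hqr),
    ramified_eq_legendreSym hr2 (not_dvd_of_ne hr hq hqr.symm)]
  push_cast
  rw [oddSign_natCast (hq.eq_two_or_odd.resolve_left hq2) (hr.eq_two_or_odd.resolve_left hr2),
    mul_comm (legendreSym q r), legendreSym.quadratic_reciprocity hq2 hr2 hqr, one_mul, ← pow_add]
  exact Even.neg_one_pow ⟨_, rfl⟩

theorem placesProd_neg_one_left {b : ℤ} (hb : b ≠ 0) : placesProd (-1) b = 1 := by
  refine int_induction (P := fun b ↦ placesProd (-1) b = 1) placesProd_neg_one_neg_one ?_ ?_ hb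
  · intro q hq
    by_cases h2 : q = 2
    · subst h2
      exact placesProd_neg_one_two
    · exact placesProd_neg_one_prime hq h2
  · intro b c hb hc h1 h2
    rw [placesProd_mul_right (by simp) hb hc, h1, h2, one_mul]

theorem placesProd_eq_one {a b : ℤ} (ha : a ≠ 0) (hb : b ≠ 0) : placesProd a b = 1 := by
  refine int_induction (P := fun a ↦ placesProd a b = 1) (placesProd_neg_one_left hb) ?_ ?_ ha
  · intro q hq
    have hq0 : (q : ℤ) ≠ 0 := by exact_mod_cast hq.ne_zero
    have hneg : placesProd q (-1) = 1 := by
      rw [placesProd_comm, placesProd_neg_one_left hq0]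
    refine int_induction (P := fun b ↦ placesProd q b = 1) hneg ?_ ?_ hb
    · intro r hr
      by_cases hqr : q = r
      · rw [← hqr, placesProd_self hq0, hneg]
      by_cases hq2 : q = 2
      · subst hq2
        exact placesProd_two_prime hr (Ne.symm hqr)
      by_cases hr2 : r = 2
      · subst hr2
        rw [placesProd_comm]
        exact placesProd_two_prime hq hq2
      exact placesProd_prime_prime hq hr hq2 hr2 hqr
    · intro b c hb hc h1 h2
      rw [placesProd_mul_right hq0 hb hc, h1, h2, one_mul]
  · intro a c ha hc h1 h2
    rw [placesProd_comm] at h1 h2 ⊢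
    rw [placesProd_mul_right hb ha hc, h1, h2, one_mul]

theorem ratCast_eq_intCast {K : Type*} [Field K] [CharZero K] (a b : ℚ) :
    hilbertSymbol (a : K) b =
      hilbertSymbol ((a.num * a.den : ℤ) : K) ((b.num * b.den : ℤ) : K) := by
  have key : ∀ q : ℚ, ((q.num * q.den : ℤ) : K) = q * (q.den : K) ^ 2 := by
    intro q
    have : (q.den : K) ≠ 0 := by exact_mod_cast q.den_ne_zero
    rw [show (q : K) = q.num / q.den from Rat.cast_def q]
    push_cast
    field_simp
  have hd : ∀ q : ℚ, (q.den : K) ≠ 0 := fun q ↦ by exact_mod_cast q.den_ne_zero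
  rw [key, key, mul_sq_left _ _ (hd a), mul_sq_right _ _ (hd b)]

end Global

end hilbertSymbol

/-- Hilbert's product formula: for nonzero rationals `a, b`, the product of the quadratic
Hilbert symbols `(a, b)_v` over all places `v` of `ℚ` (including `∞`) equals `1`. -/
theorem hilbert_product_formula (a b : ℚ) (ha : a ≠ 0) (hb : b ≠ 0) :
    hilbertSymbolReal a b * ∏ᶠ p : Nat.Primes, hilbertSymbolFin a b p p.2 = 1 := by
  have hz : ∀ q : ℚ, q ≠ 0 → (q.num * q.den : ℤ) ≠ 0 := fun q hq ↦
    mul_ne_zero (Rat.num_ne_zero.2 hq) (by exact_mod_cast q.den_ne_zero)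
  have hreal : hilbertSymbolReal a b = hilbertSymbol (a : ℝ) b := rfl
  have hfin : ∀ p : Nat.Primes, hilbertSymbolFin a b p p.2 = hilbertSymbol (a : ℚ_[p]) b :=
    fun _ ↦ rfl
  rw [hreal, finprod_congr hfin, hilbertSymbol.ratCast_eq_intCast,
    finprod_congr fun p : Nat.Primes ↦ hilbertSymbol.ratCast_eq_intCast (K := ℚ_[p]) a b]
  exact hilbertSymbol.placesProd_eq_one (hz a ha) (hz b hb)
end
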